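/- arXiv:1203.4216 — 2 statements merged into one kernel-verified Lean document; each statement's English description precedes it below -/
import Mathlib

section
/- Let X, Y : S → ℝ be centered Gaussian fields on a finite set S with E[X_s²] = E[Y_s²] for all s and E[X_s X_t] ≤ E[Y_s Y_t] for all s ≠ t. Then for every λ ∈ ℝ, P(max_{s∈S} Y_s ≥ λ) ≤ P(max_{s∈S} X_s ≥ λ). -/
open MeasureTheory ProbabilityTheory

lemma slep_third {S : Type*} [Fintype S] [DecidableEq S] (h : ℝ → ℝ) (hc : ContDiff ℝ 3 h)
    (K : ℝ) (hK : ∀ k ≤ 3, ∀ x, |iteratedDeriv k h x| ≤ K) :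
    ∃ C : ℝ, ∀ (z u : S → ℝ) (θ : ℝ),
      |iteratedDeriv 3 (fun θ => ∏ s, h (z s + u s * θ)) θ| ≤ C * ‖u‖ ^ 3 := by
  refine ⟨∑ p ∈ (Finset.univ : Finset S).sym 3, ((p : Multiset S).countPerms : ℝ) *
    K ^ Fintype.card S, fun z u θ => ?_⟩
  have hK0 : 0 ≤ K := (abs_nonneg _).trans (hK 0 (by norm_num) 0)
  have h1 : ∀ s, ContDiff ℝ 3 (fun θ => h (z s + u s * θ)) := fun s => by fun_prop
  rw [← Real.norm_eq_abs, ← norm_iteratedFDeriv_eq_norm_iteratedDeriv]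
  refine (norm_iteratedFDeriv_prod_le (fun s _ => h1 s) (n := 3) le_rfl).trans ?_
  rw [Finset.sum_mul]
  refine Finset.sum_le_sum fun p hp => ?_
  rw [mul_assoc]
  refine mul_le_mul_of_nonneg_left ?_ (by positivity)
  have hcount : ∑ s, (p : Multiset S).count s = 3 := by
    rw [Multiset.sum_count_eq_card (by simp)]; simp
  calc _ ≤ ∏ s, (K * ‖u‖ ^ ((p : Multiset S).count s)) := by
        refine Finset.prod_le_prod (fun _ _ => norm_nonneg _) fun s _ => ?_
        have hk : (p : Multiset S).count s ≤ 3 := by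
          refine le_trans ?_ hcount.le
          exact Finset.single_le_sum (f := fun s => (p : Multiset S).count s)
            (fun _ _ => Nat.zero_le _) (Finset.mem_univ s)
        generalize (p : Multiset S).count s = k at hk
        rw [norm_iteratedFDeriv_eq_norm_iteratedDeriv]
        have hc' : ContDiff ℝ k h := hc.of_le (by exact_mod_cast hk)
        have := iteratedDeriv_comp_const_mul (n := k) (f := fun x => h (z s + x)) (by fun_prop) (u s)
        rw [this, iteratedDeriv_comp_const_add]
        rw [norm_mul, norm_pow, mul_comm]
        gcongr
        · exact hK k hk _
        · exact norm_le_pi_norm u s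
    _ = _ := by
        rw [Finset.prod_mul_distrib, Finset.prod_pow_eq_pow_sum, hcount]
        simp

lemma slep_taylor {S : Type*} [Fintype S] [DecidableEq S] (h : ℝ → ℝ) (hc : ContDiff ℝ 3 h)
    (K : ℝ) (hK : ∀ k ≤ 3, ∀ x, |iteratedDeriv k h x| ≤ K) (h0 : ∀ x, 0 ≤ h x)
    (h1 : ∀ x, deriv h x ≤ 0) :
    ∃ C : ℝ, ∀ z : S → ℝ, ∃ (a : S → ℝ) (b : S → S → ℝ), (∀ s t, s ≠ t → 0 ≤ b s t) ∧
      ∀ u : S → ℝ, |(∏ s, h (z s + u s)) - ((∏ s, h (z s)) + ∑ s, a s * u s +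
        (∑ s, ∑ t, b s t * (u s * u t)) / 2)| ≤ C * ‖u‖ ^ 3 := by
  obtain ⟨C, hC⟩ := slep_third (S := S) h hc K hK
  refine ⟨C / 2, fun z => ⟨fun s => (∏ j ∈ Finset.univ.erase s, h (z j)) * deriv h (z s), 
    fun s t => if s = t then (∏ j ∈ Finset.univ.erase s, h (z j)) * deriv (deriv h) (z s) else
      (∏ j ∈ (Finset.univ.erase s).erase t, h (z j)) * deriv h (z t) * deriv h (z s), ?_, ?_⟩⟩
  · intro s t hst
    simp only [hst, if_false]
    rw [mul_assoc]
    exact mul_nonneg (Finset.prod_nonneg fun _ _ => h0 _) (mul_nonneg_of_nonpos_of_nonpos (h1 _) (h1 _))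
  intro u
  set g : ℝ → ℝ := fun θ => ∏ s, h (z s + u s * θ) with hg
  have hgc : ContDiff ℝ 3 g := by rw [hg]; fun_prop
  have hd0 : ∀ x, HasDerivAt h (deriv h x) x := fun x =>
    (hc.differentiable (by norm_num) x).hasDerivAt
  have hc2 : ContDiff ℝ 2 (deriv h) := by
    have : ContDiff ℝ (2 + 1) h := by norm_num; exact hc
    exact (contDiff_succ_iff_deriv.1 this).2.2
  have hd1 : ∀ x, HasDerivAt (deriv h) (deriv (deriv h) x) x := fun x =>
    (hc2.differentiable (by norm_num) x).hasDerivAt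
  have haff : ∀ s θ, HasDerivAt (fun θ => z s + u s * θ) (u s) θ := fun s θ => by
    simpa using ((hasDerivAt_id θ).const_mul (u s)).const_add (z s)
  have e0 : ∀ s θ, HasDerivAt (fun θ => h (z s + u s * θ)) (deriv h (z s + u s * θ) * u s) θ :=
    fun s θ => (hd0 _).comp θ (haff s θ)
  have e1 : ∀ s θ, HasDerivAt (fun θ => deriv h (z s + u s * θ) * u s)
      (deriv (deriv h) (z s + u s * θ) * u s * u s) θ :=
    fun s θ => ((hd1 _).comp θ (haff s θ)).mul_const _
  have g1 : deriv g = fun θ => ∑ s, (∏ j ∈ Finset.univ.erase s, h (z j + u j * θ)) *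
      (deriv h (z s + u s * θ) * u s) := by
    funext θ
    exact (HasDerivAt.fun_finsetProd (u := Finset.univ) (fun s _ => e0 s θ)).deriv
  have g2 : deriv (deriv g) 0 = ∑ s, ((∑ t ∈ Finset.univ.erase s, (∏ j ∈ (Finset.univ.erase s).erase t, h (z j)) * (deriv h (z t) * u t)) * (deriv h (z s) * u s)
     + (∏ j ∈ Finset.univ.erase s, h (z j)) * (deriv (deriv h) (z s) * u s * u s)) := by
    rw [g1]
    have := (HasDerivAt.fun_sum (u := Finset.univ) (fun s _ =>
      (HasDerivAt.fun_finsetProd (u := Finset.univ.erase s) (fun t _ => e0 t 0)).fun_mul (e1 s 0))).deriv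
    simpa using this
  have key := taylor_mean_remainder_bound (f := g) (a := 0) (b := 1) (x := 1) (n := 2)
    (C := C * ‖u‖ ^ 3) zero_le_one (by norm_num; exact hgc.contDiffOn) (by simp) (by
      intro y hy
      rw [iteratedDerivWithin_eq_iteratedDeriv (uniqueDiffOn_Icc one_pos) (by norm_num; exact hgc.contDiffAt) hy]
      exact hC z u y)
  have w1 : iteratedDerivWithin 1 g (Set.Icc 0 1) 0 = deriv g 0 := by
    rw [iteratedDerivWithin_eq_iteratedDeriv (uniqueDiffOn_Icc one_pos) ((hgc.of_le (by norm_num)).contDiffAt) (by simp), iteratedDeriv_one]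
  have w2 : iteratedDerivWithin 2 g (Set.Icc 0 1) 0 = deriv (deriv g) 0 := by
    rw [iteratedDerivWithin_eq_iteratedDeriv (uniqueDiffOn_Icc one_pos) ((hgc.of_le (by norm_num)).contDiffAt) (by simp), iteratedDeriv_succ, iteratedDeriv_one]
  rw [taylorWithinEval_succ, taylorWithinEval_succ, taylor_within_zero_eval] at key
  norm_num [w1, w2] at key
  rw [g2, g1] at key
  simp only [hg] at key
  have hsum : (∑ s, ∑ t, (if s = t then (∏ j ∈ Finset.univ.erase s, h (z j)) * deriv (deriv h) (z s) else
      (∏ j ∈ (Finset.univ.erase s).erase t, h (z j)) * deriv h (z t) * deriv h (z s)) * (u s * u t)) = 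
      ∑ s, ((∑ t ∈ Finset.univ.erase s, (∏ j ∈ (Finset.univ.erase s).erase t, h (z j)) * (deriv h (z t) * u t)) * (deriv h (z s) * u s)
     + (∏ j ∈ Finset.univ.erase s, h (z j)) * (deriv (deriv h) (z s) * u s * u s)) := by
    refine Finset.sum_congr rfl fun s _ => ?_
    rw [← Finset.sum_erase_add _ _ (Finset.mem_univ s), if_pos rfl, Finset.sum_mul]
    congr 1
    · refine Finset.sum_congr rfl fun t ht => ?_
      rw [if_neg (Finset.ne_of_mem_erase ht).symm]
      ring
    · ring
  rw [hsum]
  convert key using 1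
  · simp only [mul_zero, add_zero, mul_one]
    congr 1
    simp only [mul_assoc]
    ring
  · ring

/-- Law of `√t • U` when `U` has law `μ`. -/
noncomputable def slepScale {S : Type*} [Fintype S] (t : ℝ) (μ : Measure (S → ℝ)) :
    Measure (S → ℝ) :=
  μ.map (Real.sqrt t • ContinuousLinearMap.id ℝ (S → ℝ))

/-- Centered Gaussian laws. -/
def SlepCG {S : Type*} [Fintype S] (μ : Measure (S → ℝ)) : Prop :=
  ∀ L : StrongDual ℝ (S → ℝ), ∃ v : NNReal, μ.map L = gaussianReal 0 v

instance slepScale_prob {S : Type*} [Fintype S] (t : ℝ) (μ : Measure (S → ℝ))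
    [IsProbabilityMeasure μ] : IsProbabilityMeasure (slepScale t μ) :=
  Measure.isProbabilityMeasure_map (by fun_prop)

lemma slepScale_zero {S : Type*} [Fintype S] (μ : Measure (S → ℝ)) [IsProbabilityMeasure μ] :
    slepScale 0 μ = Measure.dirac 0 := by
  unfold slepScale
  have : (⇑(Real.sqrt 0 • ContinuousLinearMap.id ℝ (S → ℝ))) = fun _ => 0 := by
    ext; simp
  rw [this]; simp

lemma slepScale_one {S : Type*} [Fintype S] (μ : Measure (S → ℝ)) :
    slepScale 1 μ = μ := by
  unfold slepScale
  simp

lemma slepScale_charFunDual {S : Type*} [Fintype S] (μ : Measure (S → ℝ))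
    [IsProbabilityMeasure μ] (L : StrongDual ℝ (S → ℝ)) (v : NNReal)
    (hv : μ.map L = gaussianReal 0 v) (t : ℝ) (ht : 0 ≤ t) :
    charFunDual (slepScale t μ) L = Complex.exp (- (v * t / 2)) := by
  unfold slepScale
  rw [charFunDual_map]
  have : L.comp (Real.sqrt t • ContinuousLinearMap.id ℝ (S → ℝ)) = Real.sqrt t • L := by
    ext; simp
  rw [this, ← charFun_map_eq_charFunDual_smul, hv, charFun_gaussianReal]
  congr 1
  have : ((Real.sqrt t : ℝ) : ℂ) ^ 2 = (t : ℂ) := by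
    rw [← Complex.ofReal_pow, Real.sq_sqrt ht]
  rw [this]; simp

lemma slepScale_conv {S : Type*} [Fintype S] (μ : Measure (S → ℝ))
    [IsProbabilityMeasure μ] (hμ : SlepCG μ) (s t : ℝ) (hs : 0 ≤ s) (ht : 0 ≤ t) :
    slepScale (s + t) μ = Measure.conv (slepScale s μ) (slepScale t μ) := by
  refine Measure.ext_of_charFunDual (funext fun L => ?_)
  obtain ⟨v, hv⟩ := hμ L
  rw [charFunDual_conv, slepScale_charFunDual μ L v hv _ hs, slepScale_charFunDual μ L v hv _ ht,
    slepScale_charFunDual μ L v hv _ (add_nonneg hs ht), ← Complex.exp_add]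
  congr 1
  push_cast
  ring

lemma slep_integral_scale {S : Type*} [Fintype S] (μ : Measure (S → ℝ)) (t : ℝ)
    (F : (S → ℝ) → ℝ) (hF : Continuous F) :
    ∫ u, F u ∂(slepScale t μ) = ∫ u, F (Real.sqrt t • u) ∂μ := by
  unfold slepScale
  rw [integral_map (by fun_prop) hF.aestronglyMeasurable]
  simp

lemma slep_one_step {S : Type*} [Fintype S] [DecidableEq S] (h : ℝ → ℝ)
    (hcont : Continuous h) (hb : ∀ x, |h x| ≤ 1)
    (C : ℝ) (z a : S → ℝ) (b : S → S → ℝ)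
    (hT : ∀ u : S → ℝ, |(∏ s, h (z s + u s)) - ((∏ s, h (z s)) + ∑ s, a s * u s +
        (∑ s, ∑ t, b s t * (u s * u t)) / 2)| ≤ C * ‖u‖ ^ 3)
    (μ : Measure (S → ℝ)) [IsProbabilityMeasure μ] (hμ : SlepCG μ) (ε : ℝ) (hε : 0 ≤ ε) :
    |∫ u, ∏ s, h (z s + u s) ∂(slepScale ε μ) - ((∏ s, h (z s)) +
      ε * (∑ s, ∑ t, b s t * ∫ u, u s * u t ∂μ) / 2)| ≤
      C * Real.sqrt ε ^ 3 * ∫ u, ‖u‖ ^ 3 ∂μ := by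
  have hG : IsGaussian μ := isGaussian_of_map_eq_gaussianReal fun L => ⟨0, hμ L⟩
  rw [slep_integral_scale μ ε (fun u => ∏ s, h (z s + u s)) (by fun_prop)]
  have hco : ∀ (s : S) (p : ENNReal), p ≠ ⊤ → MemLp (fun u : S → ℝ => u s) p μ := fun s p hp =>
    IsGaussian.memLp_dual μ (ContinuousLinearMap.proj s) p hp
  have hmean : ∀ s : S, ∫ u, u s ∂μ = 0 := fun s => by
    obtain ⟨v, hv⟩ := hμ (ContinuousLinearMap.proj s)
    have h1 : ∫ x, x ∂(μ.map (ContinuousLinearMap.proj (R := ℝ) (φ := fun _ : S => ℝ) s))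
        = ∫ u, u s ∂μ := by
      rw [integral_map (by fun_prop) (by fun_prop)]
      rfl
    rw [← h1, hv, integral_id_gaussianReal]
  have hi1 : ∀ s : S, Integrable (fun u : S → ℝ => u s) μ := fun s =>
    memLp_one_iff_integrable.1 (hco s 1 (by simp))
  have hi2 : ∀ s t : S, Integrable (fun u : S → ℝ => u s * u t) μ := fun s t =>
    (hco s 2 (by simp)).integrable_mul (hco t 2 (by simp))
  have hi3 : Integrable (fun u : S → ℝ => ‖u‖ ^ 3) μ :=
    (IsGaussian.memLp_id μ 3 (by simp)).integrable_norm_pow (p := 3) (by norm_num)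
  have hA : Integrable (fun u : S → ℝ => ∏ s, h (z s + (Real.sqrt ε • u) s)) μ := by
    refine Integrable.of_bound (C := 1) (Continuous.aestronglyMeasurable (by fun_prop))
      (Filter.Eventually.of_forall fun u => ?_)
    rw [Real.norm_eq_abs, Finset.abs_prod]
    exact Finset.prod_le_one (fun _ _ => abs_nonneg _) fun _ _ => hb _
  have hB1 : Integrable (fun u : S → ℝ => ∑ s, a s * (Real.sqrt ε * u s)) μ :=
    integrable_finsetSum _ fun s _ => ((hi1 s).const_mul _).const_mul _
  have hB2 : Integrable (fun u : S → ℝ => (∑ s, ∑ t, b s t * (ε * (u s * u t))) / 2) μ :=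
    (integrable_finsetSum _ fun s _ => integrable_finsetSum _ fun t _ =>
      ((hi2 s t).const_mul _).const_mul _).div_const _
  have hB0 : Integrable (fun u : S → ℝ => (∏ s, h (z s)) + ∑ s, a s * (Real.sqrt ε * u s)) μ :=
    (integrable_const _).add hB1
  have hB : Integrable (fun u : S → ℝ => (∏ s, h (z s)) + ∑ s, a s * (Real.sqrt ε * u s) +
        (∑ s, ∑ t, b s t * (ε * (u s * u t))) / 2) μ := hB0.add hB2
  have hBeq : ∫ u, ((∏ s, h (z s)) + ∑ s, a s * (Real.sqrt ε * u s) +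
        (∑ s, ∑ t, b s t * (ε * (u s * u t))) / 2) ∂μ = (∏ s, h (z s)) +
      ε * (∑ s, ∑ t, b s t * ∫ u, u s * u t ∂μ) / 2 := by
    rw [integral_add hB0 hB2, integral_add (integrable_const _) hB1,
      integral_finsetSum _ (fun s _ => ((hi1 s).const_mul _).const_mul _), integral_div,
      integral_finsetSum _ (fun s _ => integrable_finsetSum _ fun t _ =>
      ((hi2 s t).const_mul _).const_mul _)]
    simp_rw [integral_finsetSum _ (fun t _ => ((hi2 _ t).const_mul _).const_mul _),
      integral_const_mul, hmean]
    simp [Finset.mul_sum, mul_left_comm]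
  rw [← hBeq, ← integral_sub hA hB]
  refine (abs_integral_le_integral_abs).trans ?_
  rw [← integral_const_mul]
  refine integral_mono ((hA.sub hB).abs)
    (hi3.const_mul _) fun u => ?_
  have := hT (Real.sqrt ε • u)
  rw [norm_smul, Real.norm_of_nonneg (Real.sqrt_nonneg _), mul_pow, ← mul_assoc] at this
  have hsq : ∀ s t : S, (Real.sqrt ε • u) s * (Real.sqrt ε • u) t = ε * (u s * u t) := by
    intro s t
    have := Real.mul_self_sqrt hε
    simp only [Pi.smul_apply, smul_eq_mul]
    linear_combination (u s * u t) * this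
  simp only [hsq] at this
  exact this

lemma slep_swap {S : Type*} [Fintype S] [DecidableEq S] (h : ℝ → ℝ)
    (hcont : Continuous h) (hb : ∀ x, |h x| ≤ 1) (C : ℝ)
    (hT : ∀ z : S → ℝ, ∃ (a : S → ℝ) (b : S → S → ℝ), (∀ s t, s ≠ t → 0 ≤ b s t) ∧
      ∀ u : S → ℝ, |(∏ s, h (z s + u s)) - ((∏ s, h (z s)) + ∑ s, a s * u s +
        (∑ s, ∑ t, b s t * (u s * u t)) / 2)| ≤ C * ‖u‖ ^ 3)
    (μ ν : Measure (S → ℝ)) [IsProbabilityMeasure μ] [IsProbabilityMeasure ν]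
    (hμ : SlepCG μ) (hν : SlepCG ν)
    (hvar : ∀ s, ∫ u, u s * u s ∂μ = ∫ u, u s * u s ∂ν)
    (hcov : ∀ s t, s ≠ t → ∫ u, u s * u t ∂μ ≤ ∫ u, u s * u t ∂ν) :
    ∃ D : ℝ, ∀ (z : S → ℝ) (ε : ℝ), 0 ≤ ε →
      ∫ u, ∏ s, h (z s + u s) ∂(slepScale ε μ) ≤ ∫ u, ∏ s, h (z s + u s) ∂(slepScale ε ν)
        + D * Real.sqrt ε ^ 3 := by
  refine ⟨C * ∫ u, ‖u‖ ^ 3 ∂μ + C * ∫ u, ‖u‖ ^ 3 ∂ν, fun z ε hε => ?_⟩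
  obtain ⟨a, b, hb0, hT⟩ := hT z
  have h1 := (abs_le.1 (slep_one_step h hcont hb C z a b hT μ hμ ε hε)).2
  have h2 := (abs_le.1 (slep_one_step h hcont hb C z a b hT ν hν ε hε)).1
  have h3 : ∑ s, ∑ t, b s t * ∫ u, u s * u t ∂μ ≤ ∑ s, ∑ t, b s t * ∫ u, u s * u t ∂ν := by
    refine Finset.sum_le_sum fun s _ => Finset.sum_le_sum fun t _ => ?_
    by_cases hst : s = t
    · subst hst; rw [hvar]
    · exact mul_le_mul_of_nonneg_left (hcov s t hst) (hb0 s t hst)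
  have h4 := mul_le_mul_of_nonneg_left h3 hε
  nlinarith

lemma slep_induct {S : Type*} [Fintype S] [DecidableEq S] (h : ℝ → ℝ)
    (hcont : Continuous h) (hb : ∀ x, |h x| ≤ 1) (D : ℝ)
    (μ ν : Measure (S → ℝ)) [IsProbabilityMeasure μ] [IsProbabilityMeasure ν]
    (hμ : SlepCG μ) (hν : SlepCG ν)
    (hD : ∀ (z : S → ℝ) (ε : ℝ), 0 ≤ ε →
      ∫ u, ∏ s, h (z s + u s) ∂(slepScale ε μ) ≤ ∫ u, ∏ s, h (z s + u s) ∂(slepScale ε ν)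
        + D * Real.sqrt ε ^ 3) (ε : ℝ) (hε : 0 ≤ ε) (k : ℕ) :
    ∀ ρ : Measure (S → ℝ), IsProbabilityMeasure ρ →
      ∫ x, ∏ s, h (x s) ∂(Measure.conv ρ (slepScale (k * ε) μ)) ≤
      ∫ x, ∏ s, h (x s) ∂(Measure.conv ρ (slepScale (k * ε) ν)) + k * (D * Real.sqrt ε ^ 3) := by
  have hcF : Continuous (fun x : S → ℝ => ∏ s, h (x s)) := by fun_prop
  have hbd : ∀ x : S → ℝ, ‖∏ s, h (x s)‖ ≤ 1 := fun x => by
    rw [Real.norm_eq_abs, Finset.abs_prod]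
    exact Finset.prod_le_one (fun _ _ => abs_nonneg _) fun _ _ => hb _
  have hint : ∀ ρ : Measure (S → ℝ), IsProbabilityMeasure ρ →
      Integrable (fun x : S → ℝ => ∏ s, h (x s)) ρ := fun ρ _ =>
    Integrable.of_bound (C := 1) hcF.aestronglyMeasurable (Filter.Eventually.of_forall hbd)
  have hinner : ∀ ρ τ : Measure (S → ℝ), IsProbabilityMeasure ρ → IsProbabilityMeasure τ →
      Integrable (fun z : S → ℝ => ∫ u, ∏ s, h (z s + u s) ∂τ) ρ := fun ρ τ _ _ => by
    have : Integrable (fun p : (S → ℝ) × (S → ℝ) => ∏ s, h (p.1 s + p.2 s)) (ρ.prod τ) :=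
      Integrable.of_bound (C := 1) (Continuous.aestronglyMeasurable (by fun_prop))
        (Filter.Eventually.of_forall fun p => hbd (p.1 + p.2))
    exact this.integral_prod_left
  have step : ∀ ρ : Measure (S → ℝ), IsProbabilityMeasure ρ →
      ∫ x, ∏ s, h (x s) ∂(Measure.conv ρ (slepScale ε μ)) ≤
      ∫ x, ∏ s, h (x s) ∂(Measure.conv ρ (slepScale ε ν)) + D * Real.sqrt ε ^ 3 := by
    intro ρ hρ
    rw [integral_conv (hint _ inferInstance), integral_conv (hint _ inferInstance)]
    simp only [Pi.add_apply]
    have hc : ∫ _z : S → ℝ, D * Real.sqrt ε ^ 3 ∂ρ = D * Real.sqrt ε ^ 3 := by simp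
    rw [← hc, ← integral_add (hinner ρ _ hρ inferInstance) (integrable_const _)]
    exact integral_mono (hinner ρ _ hρ inferInstance)
      ((hinner ρ _ hρ inferInstance).add (integrable_const _)) fun z => hD z ε hε
  induction k with
  | zero => intro ρ _; simp [slepScale_zero]
  | succ k ih =>
    intro ρ hρ
    have hk : 0 ≤ (k : ℝ) * ε := by positivity
    have e : ((k + 1 : ℕ) : ℝ) * ε = k * ε + ε := by push_cast; ring
    rw [e, slepScale_conv μ hμ _ _ hk hε, slepScale_conv ν hν _ _ hk hε]
    have s1 := step (Measure.conv ρ (slepScale (k * ε) μ)) inferInstance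
    have s2 := ih (Measure.conv ρ (slepScale ε ν)) inferInstance
    have e1 : Measure.conv (Measure.conv ρ (slepScale ε ν)) (slepScale (k * ε) μ) =
        Measure.conv (Measure.conv ρ (slepScale (k * ε) μ)) (slepScale ε ν) := by
      rw [Measure.conv_assoc, Measure.conv_comm (slepScale ε ν), ← Measure.conv_assoc]
    have e2 : Measure.conv (Measure.conv ρ (slepScale ε ν)) (slepScale (k * ε) ν) =
        Measure.conv ρ (Measure.conv (slepScale (k * ε) ν) (slepScale ε ν)) := by
      rw [Measure.conv_assoc, Measure.conv_comm (slepScale ε ν)]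
    rw [e1, e2] at s2
    rw [Measure.conv_assoc] at s1
    push_cast
    linarith

lemma slep_smooth {S : Type*} [Fintype S] [DecidableEq S] (h : ℝ → ℝ)
    (hcont : Continuous h) (hb : ∀ x, |h x| ≤ 1) (D : ℝ)
    (μ ν : Measure (S → ℝ)) [IsProbabilityMeasure μ] [IsProbabilityMeasure ν]
    (hμ : SlepCG μ) (hν : SlepCG ν)
    (hD : ∀ (z : S → ℝ) (ε : ℝ), 0 ≤ ε →
      ∫ u, ∏ s, h (z s + u s) ∂(slepScale ε μ) ≤ ∫ u, ∏ s, h (z s + u s) ∂(slepScale ε ν)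
        + D * Real.sqrt ε ^ 3) :
    ∫ x, ∏ s, h (x s) ∂μ ≤ ∫ x, ∏ s, h (x s) ∂ν := by
  have key : ∀ n : ℕ, ∫ x, ∏ s, h (x s) ∂μ ≤ ∫ x, ∏ s, h (x s) ∂ν +
      D * Real.sqrt (1 / ((n : ℝ) + 1)) := by
    intro n
    have hn : (0 : ℝ) < (n : ℝ) + 1 := by positivity
    have := slep_induct h hcont hb D μ ν hμ hν hD (1 / ((n : ℝ) + 1)) (by positivity) (n + 1)
      (Measure.dirac 0) inferInstance
    have e : ((n + 1 : ℕ) : ℝ) * (1 / ((n : ℝ) + 1)) = 1 := by push_cast; field_simp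
    rw [e, slepScale_one, slepScale_one, Measure.dirac_zero_conv, Measure.dirac_zero_conv] at this
    have e3 : ((n + 1 : ℕ) : ℝ) * (D * Real.sqrt (1 / ((n : ℝ) + 1)) ^ 3) =
        D * Real.sqrt (1 / ((n : ℝ) + 1)) := by
      rw [pow_succ, Real.sq_sqrt (by positivity)]
      push_cast; field_simp
    rwa [e3] at this
  have lim : Filter.Tendsto (fun n : ℕ => ∫ x, ∏ s, h (x s) ∂ν +
      D * Real.sqrt (1 / ((n : ℝ) + 1))) Filter.atTop (nhds (∫ x, ∏ s, h (x s) ∂ν)) := by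
    have := (Real.continuous_sqrt.tendsto 0).comp (tendsto_one_div_add_atTop_nhds_zero_nat (𝕜 := ℝ))
    simpa using (this.const_mul D).const_add (∫ x, ∏ s, h (x s) ∂ν)
  exact ge_of_tendsto' lim key

lemma slep_bdd (h : ℝ → ℝ) (hc : ContDiff ℝ 3 h) (A B cA cB : ℝ)
    (hA : ∀ x < A, h x = cA) (hB : ∀ x > B, h x = cB) :
    ∃ K, ∀ k ≤ 3, ∀ x, |iteratedDeriv k h x| ≤ K := by
  have h1 : ∀ k : ℕ, ∃ K, 0 ≤ K ∧ (k ≤ 3 → ∀ x, |iteratedDeriv k h x| ≤ K) := by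
    intro k
    by_cases hk : k ≤ 3
    swap
    · exact ⟨0, le_rfl, fun h => absurd h hk⟩
    have hcont : Continuous (iteratedDeriv k h) :=
      hc.continuous_iteratedDeriv k (by exact_mod_cast hk)
    obtain ⟨K, hK⟩ := (isCompact_Icc (a := A) (b := B)).exists_bound_of_continuousOn
      hcont.continuousOn
    have hconst : ∀ c x : ℝ, |iteratedDeriv k (fun _ => c) x| ≤ |c| := by
      intro c x
      rw [iteratedDeriv_const]
      split_ifs <;> simp
    refine ⟨max K (max |cA| |cB|), by positivity, fun _ x => ?_⟩
    by_cases hxA : x < A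
    · have : h =ᶠ[nhds x] fun _ => cA := by
        filter_upwards [Iio_mem_nhds hxA] with y hy using hA y hy
      rw [this.iteratedDeriv_eq]
      exact (hconst _ _).trans (by simp)
    by_cases hxB : B < x
    · have : h =ᶠ[nhds x] fun _ => cB := by
        filter_upwards [Ioi_mem_nhds hxB] with y hy using hB y hy
      rw [this.iteratedDeriv_eq]
      exact (hconst _ _).trans (by simp)
    exact (hK x ⟨not_lt.1 hxA, not_lt.1 hxB⟩).trans (le_max_left _ _)
  choose K hK0 hK using h1
  refine ⟨∑ k ∈ Finset.range 4, K k, fun k hk x => (hK k hk x).trans ?_⟩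
  exact Finset.single_le_sum (f := K) (fun i _ => hK0 i) (Finset.mem_range.2 (by omega))

lemma slep_measure {S : Type*} [Fintype S] 
    (μ ν : Measure (S → ℝ)) [IsProbabilityMeasure μ] [IsProbabilityMeasure ν]
    (hμ : SlepCG μ) (hν : SlepCG ν)
    (hvar : ∀ s, ∫ u, u s * u s ∂μ = ∫ u, u s * u s ∂ν)
    (hcov : ∀ s t, s ≠ t → ∫ u, u s * u t ∂μ ≤ ∫ u, u s * u t ∂ν) (lam : ℝ) :
    μ {x | ∀ s, x s < lam} ≤ ν {x | ∀ s, x s < lam} := by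
  classical
  let h : ℕ → ℝ → ℝ := fun n x => Real.smoothTransition ((lam - x) * (n + 1))
  have hc : ∀ n, ContDiff ℝ 3 (h n) := fun n => by
    have h3 : ContDiff ℝ 3 Real.smoothTransition := Real.smoothTransition.contDiff (n := 3)
    exact h3.comp (by fun_prop)
  have h0 : ∀ n x, 0 ≤ h n x := fun n x => Real.smoothTransition.nonneg _
  have hb : ∀ n x, |h n x| ≤ 1 := fun n x => by
    rw [abs_of_nonneg (h0 n x)]; exact Real.smoothTransition.le_one _
  have hanti : ∀ n, Antitone (h n) := fun n x y hxy => by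
    apply Real.smoothTransition.monotone
    gcongr
  have hint : ∀ n, ∫ x, ∏ s, h n (x s) ∂μ ≤ ∫ x, ∏ s, h n (x s) ∂ν := by
    intro n
    obtain ⟨K, hK⟩ := slep_bdd (h n) (hc n) (lam - 1) lam 1 0 (fun x hx => by
        apply Real.smoothTransition.one_of_one_le
        have : (0 : ℝ) ≤ n := Nat.cast_nonneg n
        nlinarith) (fun x hx => by
        apply Real.smoothTransition.zero_of_nonpos
        have : (0 : ℝ) ≤ n := Nat.cast_nonneg n
        nlinarith)
    obtain ⟨C, hC⟩ := slep_taylor (S := S) (h n) (hc n) K hK (h0 n) (fun x => (hanti n).deriv_nonpos)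
    obtain ⟨D, hD⟩ := slep_swap (h n) (hc n).continuous (hb n) C hC μ ν hμ hν hvar hcov
    exact slep_smooth (h n) (hc n).continuous (hb n) D μ ν hμ hν hD
  have hmeas : MeasurableSet {x : S → ℝ | ∀ s, x s < lam} := by
    rw [Set.ofPred_forall]
    exact MeasurableSet.iInter fun s => measurableSet_lt (measurable_pi_apply s) measurable_const
  have hpt : ∀ x : S → ℝ, Filter.Tendsto (fun n => ∏ s, h n (x s)) Filter.atTop
      (nhds ({x : S → ℝ | ∀ s, x s < lam}.indicator (fun _ => (1 : ℝ)) x)) := by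
    intro x
    by_cases hx : ∀ s, x s < lam
    · rw [Set.indicator_of_mem (by exact hx)]
      have : ∀ s, Filter.Tendsto (fun n => h n (x s)) Filter.atTop (nhds 1) := by
        intro s
        have hs : 0 < lam - x s := sub_pos.2 (hx s)
        obtain ⟨N, hN⟩ := exists_nat_gt (1 / (lam - x s))
        refine tendsto_const_nhds.congr' ?_
        filter_upwards [Filter.eventually_ge_atTop N] with n hn
        refine (Real.smoothTransition.one_of_one_le ?_).symm
        rw [div_lt_iff₀ hs] at hN
        have : (N : ℝ) ≤ n := by exact_mod_cast hn
        nlinarith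
      simpa using tendsto_finsetProd Finset.univ fun s _ => this s
    · rw [Set.indicator_of_notMem (by exact hx)]
      push Not at hx
      obtain ⟨s, hs⟩ := hx
      refine tendsto_const_nhds.congr fun n => ?_
      refine (Finset.prod_eq_zero (Finset.mem_univ s) ?_).symm
      apply Real.smoothTransition.zero_of_nonpos
      exact mul_nonpos_of_nonpos_of_nonneg (by linarith) (by positivity)
  have hlim : ∀ τ : Measure (S → ℝ), IsProbabilityMeasure τ →
      Filter.Tendsto (fun n => ∫ x, ∏ s, h n (x s) ∂τ) Filter.atTop
        (nhds (τ.real {x | ∀ s, x s < lam})) := by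
    intro τ _
    have e : τ.real {x | ∀ s, x s < lam} =
        ∫ x, {x : S → ℝ | ∀ s, x s < lam}.indicator (fun _ => (1 : ℝ)) x ∂τ := by
      rw [integral_indicator hmeas]; simp
    rw [e]
    refine tendsto_integral_of_dominated_convergence (fun _ => 1) (fun n => ?_)
      (integrable_const _) (fun n => Filter.Eventually.of_forall fun x => ?_)
      (Filter.Eventually.of_forall hpt)
    · have := (hc n).continuous
      exact Continuous.aestronglyMeasurable (by fun_prop)
    · rw [Real.norm_eq_abs, Finset.abs_prod]
      exact Finset.prod_le_one (fun _ _ => abs_nonneg _) fun _ _ => hb n _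
  have hle := le_of_tendsto_of_tendsto' (hlim μ inferInstance) (hlim ν inferInstance) hint
  exact (ENNReal.toReal_le_toReal (measure_ne_top _ _) (measure_ne_top _ _)).1 hle

lemma slep_law {S : Type*} [Fintype S] {Ω : Type*} [MeasurableSpace Ω] (P : Measure Ω)
    (X : S → Ω → ℝ) (hXm : ∀ s, Measurable (X s))
    (hXgauss : ∀ a : S → ℝ, ∃ v : NNReal,
      P.map (fun ω => ∑ s, a s * X s ω) = gaussianReal 0 v) :
    SlepCG (P.map (fun ω s => X s ω)) := by
  classical
  intro L
  obtain ⟨v, hv⟩ := hXgauss (fun s => L (Pi.single s 1))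
  refine ⟨v, ?_⟩
  rw [← hv, Measure.map_map (by fun_prop) (measurable_pi_lambda _ hXm)]
  congr 1
  funext ω
  simp only [Function.comp]
  conv_lhs => rw [pi_eq_sum_univ' (fun s => X s ω)]
  rw [map_sum]
  refine Finset.sum_congr rfl fun s _ => ?_
  rw [map_smul, smul_eq_mul, mul_comm]

lemma slep_compl {S : Type*} [Fintype S] [Nonempty S] {Ω : Type*} [MeasurableSpace Ω]
    (P : Measure Ω) [IsProbabilityMeasure P]
    (X : S → Ω → ℝ) (hXm : ∀ s, Measurable (X s)) (lam : ℝ) :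
    P {ω | lam ≤ ⨆ s, X s ω} = 1 - P.map (fun ω s => X s ω) {x | ∀ s, x s < lam} := by
  have hmeas : MeasurableSet {x : S → ℝ | ∀ s, x s < lam} := by
    rw [Set.ofPred_forall]
    exact MeasurableSet.iInter fun s => measurableSet_lt (measurable_pi_apply s) measurable_const
  have hm : Measurable (fun ω s => X s ω) := measurable_pi_lambda _ hXm
  rw [Measure.map_apply hm hmeas, ← prob_compl_eq_one_sub (hm hmeas)]
  congr 1
  ext ω
  simp only [Set.mem_ofPred_eq, Set.mem_compl_iff, Set.mem_preimage, not_forall, not_lt]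
  constructor
  · intro hl
    obtain ⟨s, hs⟩ := exists_eq_ciSup_of_finite (f := fun s => X s ω)
    exact ⟨s, hl.trans hs.ge⟩
  · rintro ⟨s, hs⟩
    exact hs.trans (le_ciSup (f := fun s => X s ω) (Set.finite_range _).bddAbove s)

/-- Slepian's comparison inequality: for centered Gaussian fields `X`, `Y` on a finite set
with equal variances and `E[X_s X_t] ≤ E[Y_s Y_t]` for `s ≠ t`, one has
`P(max Y ≥ λ) ≤ P(max X ≥ λ)`. -/
theorem stmt17 {S : Type*} [Fintype S] [Nonempty S]
    {Ω : Type*} [MeasurableSpace Ω] (P : Measure Ω) [IsProbabilityMeasure P]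
    (X Y : S → Ω → ℝ)
    (hXm : ∀ s, Measurable (X s)) (hYm : ∀ s, Measurable (Y s))
    (hXgauss : ∀ a : S → ℝ, ∃ v : NNReal,
      P.map (fun ω => ∑ s, a s * X s ω) = gaussianReal 0 v)
    (hYgauss : ∀ a : S → ℝ, ∃ v : NNReal,
      P.map (fun ω => ∑ s, a s * Y s ω) = gaussianReal 0 v)
    (hvar : ∀ s, ∫ ω, (X s ω) ^ 2 ∂P = ∫ ω, (Y s ω) ^ 2 ∂P)
    (hcov : ∀ s t, s ≠ t → ∫ ω, X s ω * X t ω ∂P ≤ ∫ ω, Y s ω * Y t ω ∂P)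
    (lam : ℝ) :
    P {ω | lam ≤ ⨆ s, Y s ω} ≤ P {ω | lam ≤ ⨆ s, X s ω} := by
  have hmX : Measurable (fun ω s => X s ω) := measurable_pi_lambda _ hXm
  have hmY : Measurable (fun ω s => Y s ω) := measurable_pi_lambda _ hYm
  have : IsProbabilityMeasure (P.map (fun ω s => X s ω)) :=
    Measure.isProbabilityMeasure_map hmX.aemeasurable
  have : IsProbabilityMeasure (P.map (fun ω s => Y s ω)) :=
    Measure.isProbabilityMeasure_map hmY.aemeasurable
  have eX : ∀ s t, ∫ u, u s * u t ∂(P.map (fun ω s => X s ω)) = ∫ ω, X s ω * X t ω ∂P :=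
    fun s t => integral_map hmX.aemeasurable (Continuous.aestronglyMeasurable (by fun_prop))
  have eY : ∀ s t, ∫ u, u s * u t ∂(P.map (fun ω s => Y s ω)) = ∫ ω, Y s ω * Y t ω ∂P :=
    fun s t => integral_map hmY.aemeasurable (Continuous.aestronglyMeasurable (by fun_prop))
  rw [slep_compl P X hXm, slep_compl P Y hYm]
  refine tsub_le_tsub_left (slep_measure _ _ (slep_law P X hXm hXgauss)
    (slep_law P Y hYm hYgauss) (fun s => ?_) (fun s t hst => ?_) lam) 1
  · rw [eX, eY]
    simpa only [pow_two] using hvar s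
  · rw [eX, eY]
    exact hcov s t hst
end

section
/- Let G be a probability measure on a finite set S, q : S×S → [0,1] a symmetric function, and X : S → ℝ. Suppose for each x ∈ S the quantity ∑_{x'} q̃(x,x') G(x') appears via Gaussian integration by parts with E[X̃_x X_{x'}] = ((q(x,x')−α)⁺)·log N + O(1). Then (β log N)^{-1} E[∑_x X̃_x G_{β,N}(x)] = ∫_α^1 E[G_{β,N}^{×2}{q₁₂ ≤ s}] ds + O(1/log N), where G_{β,N}(x) = e^{βX_x}/∑_z e^{βX_z} is the Gibbs measure and X̃_x = X_x − X_x(α). -/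
open MeasureTheory ProbabilityTheory

/-- Distance on the circle `[0,1]_∼`. -/
noncomputable def circDist (x y : ℝ) : ℝ := min |x - y| (1 - |x - y|)

/-- The overlap `q(x_i, x_j) = −log‖x_i−x_j‖ / log N` of two points of `X_N`,
with `q = 1` on the diagonal. -/
noncomputable def overlapQ (N : ℕ) (i j : Fin N) : ℝ :=
  if i = j then 1 else -Real.log (circDist ((i : ℝ) / N) ((j : ℝ) / N)) / Real.log N


lemma stein1d (v : NNReal) (hv : v ≠ 0) (f f' : ℝ → ℝ) (hd : ∀ x, HasDerivAt f (f' x) x)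
    (hc : Continuous f') (K : ℝ) (hf : ∀ x, |f x| ≤ K) (hf' : ∀ x, |f' x| ≤ K) :
    ∫ y, y * f y ∂(gaussianReal 0 v) = v * ∫ y, f' y ∂(gaussianReal 0 v) := by
  have hfc : Continuous f := continuous_iff_continuousAt.2 fun x => (hd x).continuousAt
  have hv' : (v : ℝ) ≠ 0 := by exact_mod_cast hv
  have hpd : ∀ x, HasDerivAt (gaussianPDFReal 0 v) (-(x / v) * gaussianPDFReal 0 v x) x := by
    intro x
    have h1 : HasDerivAt (fun x : ℝ => -(x - 0) ^ 2 / (2 * v)) (-(x / v)) x := by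
      have := (((hasDerivAt_id x).sub_const 0).pow 2).neg.div_const (2 * (v:ℝ))
      refine this.congr_deriv ?_
      simp
      field_simp
    have := (h1.exp).const_mul ((√(2 * Real.pi * v))⁻¹)
    refine this.congr_deriv ?_
    unfold gaussianPDFReal
    ring
  have hp : Integrable (gaussianPDFReal 0 v) := integrable_gaussianPDFReal 0 v
  have hxp : Integrable (fun x => x * gaussianPDFReal 0 v x) := by
    have h : Integrable (fun x : ℝ => x) (gaussianReal 0 v) :=
      (memLp_id_gaussianReal (μ := 0) (v := v) 1).integrable (by simp)
    rw [gaussianReal_of_var_ne_zero _ hv,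
      integrable_withDensity_iff_integrable_smul' (measurable_gaussianPDF _ _)
        (by simp [gaussianPDF])] at h
    refine h.congr (Filter.Eventually.of_forall fun x => ?_)
    simp [mul_comm]
  rw [integral_gaussianReal_eq_integral_smul hv, integral_gaussianReal_eq_integral_smul hv]
  have key := integral_mul_deriv_eq_deriv_mul_of_integrable (u := f) (u' := f')
    (v := gaussianPDFReal 0 v) (v' := fun x => -(x / v) * gaussianPDFReal 0 v x)
    (fun x _ => hd x) (fun x _ => hpd x) ?_ ?_ ?_
  · have e1 : ∫ x, gaussianPDFReal 0 v x • (x * f x)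
        = -v * ∫ x, f x * (-(x / v) * gaussianPDFReal 0 v x) := by
      rw [← integral_const_mul]
      congr 1; ext x; simp; field_simp
    rw [e1, key]
    simp [mul_comm]
  · have := (hxp.const_mul (-(v:ℝ)⁻¹)).bdd_mul (c := K) hfc.aestronglyMeasurable
      (Filter.Eventually.of_forall hf)
    refine this.congr (Filter.Eventually.of_forall fun x => ?_)
    simp; left; ring
  · exact hp.bdd_mul (c := K) hc.aestronglyMeasurable (Filter.Eventually.of_forall hf')
  · exact hp.bdd_mul (c := K) hfc.aestronglyMeasurable (Filter.Eventually.of_forall hf)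

lemma gibp {Ω : Type} [MeasurableSpace Ω] (P : Measure Ω) [IsProbabilityMeasure P] {N : ℕ}
    (Y : Ω → ℝ) (X : Fin N → Ω → ℝ) (hY : Measurable Y) (hX : ∀ j, Measurable (X j))
    (hG : ∀ (b : ℝ) (a : Fin N → ℝ), ∃ v : NNReal,
      P.map (fun ω => b * Y ω + ∑ j, a j * X j ω) = gaussianReal 0 v)
    (s : ℝ) (hs : 0 < s) (hYs : ∫ ω, Y ω ^ 2 ∂P = s)
    (F : (Fin N → ℝ) → ℝ) (F' : Fin N → (Fin N → ℝ) → ℝ)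
    (hd : ∀ (z d : Fin N → ℝ) (t : ℝ), HasDerivAt (fun t : ℝ => F (fun j => z j + t * d j))
      (∑ j, d j * F' j (fun j => z j + t * d j)) t)
    (hFc : Continuous F) (hF'c : ∀ j, Continuous (F' j))
    (K : ℝ) (hFK : ∀ x, |F x| ≤ K) (hF'K : ∀ j x, |F' j x| ≤ K) :
    ∫ ω, Y ω * F (fun j => X j ω) ∂P
      = ∑ j, (∫ ω, Y ω * X j ω ∂P) * ∫ ω, F' j (fun k => X k ω) ∂P := by
  classical
  -- joint Gaussian law
  have hlaw : HasGaussianLaw (fun ω => (Y ω, fun j => X j ω)) P := by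
    refine ⟨isGaussian_of_map_eq_gaussianReal fun L => ?_⟩
    obtain ⟨v, hv⟩ := hG (L (1, 0)) (fun j => L (0, Pi.single j 1))
    refine ⟨0, v, ?_⟩
    rw [Measure.map_map (by fun_prop) (by fun_prop), ← hv]
    congr 1
    ext ω
    have : ((Y ω, fun j => X j ω) : ℝ × (Fin N → ℝ))
        = Y ω • ((1 : ℝ), (0 : Fin N → ℝ)) + ∑ j, X j ω • ((0 : ℝ), (Pi.single j 1 : Fin N → ℝ)) := by
      ext k
      · simp [Prod.fst_sum]
      · simp [Prod.snd_sum, Finset.sum_apply, Pi.single_apply]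
    simp only [Function.comp]
    rw [this, map_add, map_sum, map_smul]
    simp_rw [map_smul, smul_eq_mul, mul_comm]
  have hYG : HasGaussianLaw Y P := hlaw.fst
  have hXG : ∀ j, HasGaussianLaw (X j) P := fun j => hlaw.snd.eval j
  have hY0 : ∫ ω, Y ω ∂P = 0 := by
    obtain ⟨v, hv⟩ := hG 1 0
    simp only [one_mul, Pi.zero_apply, zero_mul, Finset.sum_const_zero, add_zero] at hv
    have := integral_map (μ := P) (φ := Y) hY.aemeasurable (f := fun x => x) (by fun_prop)
    rw [← this, hv, integral_id_gaussianReal]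
  have hYmap : P.map Y = gaussianReal 0 s.toNNReal := by
    rw [hYG.map_eq_gaussianReal, hY0, variance_of_integral_eq_zero hY.aemeasurable hY0, hYs]
  set c : Fin N → ℝ := fun j => ∫ ω, Y ω * X j ω ∂P with hc
  set d : Fin N → ℝ := fun j => c j / s with hdd
  let Z : Fin N → Ω → ℝ := fun j ω => X j ω - Y ω * d j
  have hZm : ∀ j, Measurable (Z j) := fun j => (hX j).sub (hY.mul_const _)
  have hlaw2 : HasGaussianLaw (fun ω => ((fun _ : Unit => Y ω), fun j => Z j ω)) P := by
    let L : (ℝ × (Fin N → ℝ)) →L[ℝ] ((Unit → ℝ) × (Fin N → ℝ)) :=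
      (ContinuousLinearMap.pi fun _ => ContinuousLinearMap.fst ℝ ℝ (Fin N → ℝ)).prod
        (ContinuousLinearMap.snd ℝ ℝ (Fin N → ℝ)
          - (ContinuousLinearMap.fst ℝ ℝ (Fin N → ℝ)).smulRight d)
    have := hlaw.map_fun L
    exact this
  have hindep : IndepFun Y (fun ω j => Z j ω) P := by
    have h1 := HasGaussianLaw.indepFun_of_covariance_eval (X := fun _ : Unit => Y) (Y := Z) hlaw2 ?_
    · exact h1.comp (φ := fun f : Unit → ℝ => f ()) (ψ := id) (by fun_prop) (by fun_prop)
    · intro _ j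
      have hY2 := hYG.memLp_two
      have hX2 := (hXG j).memLp_two
      have hZ2 : MemLp (Z j) 2 P := hX2.sub (hY2.mul_const _)
      rw [covariance_eq_sub hY2 hZ2, hY0, zero_mul, sub_zero]
      have e : ∀ ω, (Y * Z j) ω = Y ω * X j ω - Y ω ^ 2 * d j := fun ω => by
        simp [Z]; ring
      simp_rw [e]
      have hi : Integrable (fun ω => Y ω * X j ω) P := hY2.integrable_mul hX2
      rw [integral_sub hi (hY2.integrable_sq.mul_const _),
        integral_mul_const, hYs, hdd]
      simp only [hc]
      field_simp
      simp
  have hmap : P.map (fun ω => (Y ω, fun j => Z j ω))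
      = (P.map Y).prod (P.map fun ω j => Z j ω) := (indepFun_iff_map_prod_eq_prod_map_map hY.aemeasurable
    (measurable_pi_lambda _ hZm).aemeasurable).1 hindep
  have hmapm : Measurable (fun ω => (Y ω, fun j => Z j ω)) :=
    hY.prodMk (measurable_pi_lambda _ hZm)
  have hXZ : ∀ ω, (fun j => X j ω) = fun j => Z j ω + Y ω * d j := fun ω => by
    ext j; simp [Z]
  have hνp : IsProbabilityMeasure (P.map fun ω j => Z j ω) :=
    Measure.isProbabilityMeasure_map (measurable_pi_lambda _ hZm).aemeasurable
  set ν := P.map fun ω j => Z j ω with hν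
  have hcont : Continuous (fun p : ℝ × (Fin N → ℝ) => fun j => p.2 j + p.1 * d j) := by fun_prop
  have hYint : Integrable Y P := hYG.integrable
  have hK' : ∀ x, |∑ j, d j * F' j x| ≤ ∑ j, |d j| * K := fun x =>
    (Finset.abs_sum_le_sum_abs _ _).trans (Finset.sum_le_sum fun j _ => by
      rw [abs_mul]; exact mul_le_mul_of_nonneg_left (hF'K j x) (abs_nonneg _))
  have hS : Continuous (fun x => ∑ j, d j * F' j x) := by fun_prop
  have hm1 : Continuous (fun p : ℝ × (Fin N → ℝ) => p.1 * F (fun j => p.2 j + p.1 * d j)) := by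
    fun_prop
  have hm2 : Continuous (fun p : ℝ × (Fin N → ℝ) =>
      (fun x => ∑ j, d j * F' j x) (fun j => p.2 j + p.1 * d j)) := by
    fun_prop
  have hL : ∫ ω, Y ω * F (fun j => X j ω) ∂P
      = ∫ z, ∫ y, y * F (fun j => z j + y * d j) ∂(gaussianReal 0 s.toNNReal) ∂ν := by
    have h1 : ∫ ω, Y ω * F (fun j => X j ω) ∂P
        = ∫ p, p.1 * F (fun j => p.2 j + p.1 * d j) ∂(P.map fun ω => (Y ω, fun j => Z j ω)) := by
      rw [integral_map hmapm.aemeasurable hm1.aestronglyMeasurable]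
      simp_rw [hXZ]
    rw [h1, hmap, hYmap, integral_prod_symm]
    rw [← hYmap, ← hmap, integrable_map_measure
        hm1.aestronglyMeasurable hmapm.aemeasurable]
    have : Integrable (fun ω => F (fun j => Z j ω + Y ω * d j) * Y ω) P :=
      hYint.bdd_mul (c := K) ((hFc.measurable.comp (hcont.measurable.comp hmapm)).aestronglyMeasurable)
        (Filter.Eventually.of_forall fun ω => hFK _)
    exact this.congr (Filter.Eventually.of_forall fun ω => mul_comm _ _)
  have hR : ∫ ω, (∑ j, d j * F' j (fun k => X k ω)) ∂P
      = ∫ z, ∫ y, (∑ j, d j * F' j (fun k => z k + y * d k)) ∂(gaussianReal 0 s.toNNReal) ∂ν := by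
    have h1 : ∫ ω, (∑ j, d j * F' j (fun k => X k ω)) ∂P
        = ∫ p, (fun x => ∑ j, d j * F' j x) (fun j => p.2 j + p.1 * d j)
          ∂(P.map fun ω => (Y ω, fun j => Z j ω)) := by
      rw [integral_map hmapm.aemeasurable hm2.aestronglyMeasurable]
      simp_rw [hXZ]
    rw [h1, hmap, hYmap, integral_prod_symm]
    exact Integrable.of_bound (hS.comp hcont).aestronglyMeasurable _
      (Filter.Eventually.of_forall fun ω => hK' _)
  have hst : ∀ z : Fin N → ℝ, ∫ y, y * F (fun j => z j + y * d j) ∂(gaussianReal 0 s.toNNReal)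
      = s * ∫ y, (∑ j, d j * F' j (fun k => z k + y * d k)) ∂(gaussianReal 0 s.toNNReal) := by
    intro z
    have := stein1d s.toNNReal (by simpa using hs) (fun y => F (fun j => z j + y * d j))
      (fun y => ∑ j, d j * F' j (fun k => z k + y * d k)) (hd z d) (by fun_prop)
      (max K (∑ j, |d j| * K)) (fun x => (hFK _).trans (le_max_left _ _))
      (fun x => (hK' _).trans (le_max_right _ _))
    rwa [Real.coe_toNNReal _ hs.le] at this
  rw [hL]
  simp_rw [hst]
  rw [integral_const_mul, ← hR, integral_finsetSum, Finset.mul_sum]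
  · refine Finset.sum_congr rfl fun j _ => ?_
    rw [integral_const_mul, hdd]
    simp only [hc]
    field_simp
  · intro j _
    refine Integrable.const_mul ?_ _
    exact Integrable.of_bound ((hF'c j).measurable.comp
      (measurable_pi_lambda _ hX)).aestronglyMeasurable K
      (Filter.Eventually.of_forall fun ω => hF'K j _)

lemma overlapQ_le_one (N : ℕ) (hN : 2 ≤ N) (i j : Fin N) : overlapQ N i j ≤ 1 := by
  unfold overlapQ
  split_ifs with h
  · exact le_rfl
  have hN0 : (0 : ℝ) < N := by exact_mod_cast (by omega : 0 < N)
  have hlog : 0 < Real.log N := Real.log_pos (by exact_mod_cast (by omega : 1 < N))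
  rw [div_le_one hlog]
  have h1 : (1 : ℝ) ≤ |(i : ℝ) - j| := by
    have : (1 : ℤ) ≤ |((i : ℕ) : ℤ) - ((j : ℕ) : ℤ)| := by
      refine Int.one_le_abs ?_
      have : (i : ℕ) ≠ j := fun h' => h (Fin.ext h')
      omega
    exact_mod_cast this
  have h2 : |(i : ℝ) - j| ≤ N - 1 := by
    have : |((i : ℕ) : ℤ) - ((j : ℕ) : ℤ)| ≤ (N : ℤ) - 1 := by
      have := i.2
      have := j.2
      rw [abs_le]; omega
    exact_mod_cast this
  have h3 : (N : ℝ)⁻¹ ≤ circDist ((i : ℝ) / N) ((j : ℝ) / N) := by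
    unfold circDist
    have e : |(i : ℝ) / N - (j : ℝ) / N| = |(i : ℝ) - j| / N := by
      rw [← sub_div, abs_div, abs_of_pos hN0]
    rw [e, le_min_iff]
    constructor
    · rw [inv_eq_one_div]; gcongr
    · rw [inv_eq_one_div, le_sub_iff_add_le, ← add_div, div_le_one hN0]; linarith
  have := Real.log_le_log (inv_pos.2 hN0) h3
  rw [Real.log_inv] at this
  linarith

lemma integral_ind (α q e : ℝ) (he : 0 ≤ e) (hα : α ≤ 1) (hq : q ≤ 1) :
    IntervalIntegrable (fun s => if q ≤ s then e else 0) volume α 1 ∧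
    ∫ s in α..(1 : ℝ), (if q ≤ s then e else 0) = e * (1 - α - max (q - α) 0) := by
  have hmono : Monotone (fun s => if q ≤ s then e else 0) := by
    intro a b hab
    dsimp only
    split_ifs with h1 h2
    · exact le_rfl
    · exact absurd (h1.trans hab) h2
    · exact he
    · exact le_rfl
  refine ⟨hmono.intervalIntegrable, ?_⟩
  rw [← intervalIntegral.integral_add_adjacent_intervals (b := max q α)
    hmono.intervalIntegrable hmono.intervalIntegrable]
  have h1 : ∫ s in α..max q α, (if q ≤ s then e else 0) = ∫ s in α..max q α, (0 : ℝ) := by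
    refine intervalIntegral.integral_congr_ae ?_
    have : ∀ᵐ s : ℝ, s ≠ q := by simp [ae_iff]
    filter_upwards [this] with s hs hs'
    rw [Set.uIoc_of_le (le_max_right _ _)] at hs'
    rw [if_neg]
    intro hle
    rcases le_max_iff.1 hs'.2 with h | h
    · exact hs (le_antisymm h hle)
    · exact absurd hs'.1 (not_lt.2 h)
  have h2 : ∫ s in (max q α)..1, (if q ≤ s then e else 0) = ∫ s in (max q α)..1, e := by
    refine intervalIntegral.integral_congr fun s hs => ?_
    rw [Set.uIcc_of_le (max_le hq hα)] at hs
    exact if_pos ((le_max_left _ _).trans hs.1)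
  rw [h1, h2, intervalIntegral.integral_zero, intervalIntegral.integral_const]
  have : max q α = max (q - α) 0 + α := by
    rw [← max_add_add_right, sub_add_cancel, zero_add]
  rw [this, smul_eq_mul]
  ring

/-- Softmax. -/
noncomputable def smx {N : ℕ} (β : ℝ) (i : Fin N) (x : Fin N → ℝ) : ℝ :=
  Real.exp (β * x i) / ∑ z, Real.exp (β * x z)

lemma smx_den_pos {N : ℕ} (β : ℝ) (i : Fin N) (x : Fin N → ℝ) :
    0 < ∑ z, Real.exp (β * x z) :=
  Finset.sum_pos (fun _ _ => Real.exp_pos _) ⟨i, Finset.mem_univ i⟩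

lemma smx_nonneg {N : ℕ} (β : ℝ) (i : Fin N) (x : Fin N → ℝ) : 0 ≤ smx β i x :=
  div_nonneg (Real.exp_pos _).le (smx_den_pos β i x).le

lemma smx_le_one {N : ℕ} (β : ℝ) (i : Fin N) (x : Fin N → ℝ) : smx β i x ≤ 1 := by
  unfold smx
  rw [div_le_one (smx_den_pos β i x)]
  exact Finset.single_le_sum (f := fun z => Real.exp (β * x z))
    (fun _ _ => (Real.exp_pos _).le) (Finset.mem_univ i)

lemma smx_sum {N : ℕ} (hN : 2 ≤ N) (β : ℝ) (x : Fin N → ℝ) : ∑ i, smx β i x = 1 := by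
  unfold smx
  rw [← Finset.sum_div]
  exact div_self (smx_den_pos β ⟨0, by omega⟩ x).ne'

lemma smx_cont {N : ℕ} (β : ℝ) (i : Fin N) : Continuous (smx β i) := by
  unfold smx
  refine Continuous.div (by fun_prop) (by fun_prop) fun x => (smx_den_pos β i x).ne'

lemma smx_deriv {N : ℕ} (β : ℝ) (i : Fin N) (z d : Fin N → ℝ) (t : ℝ) :
    HasDerivAt (fun t : ℝ => smx β i (fun j => z j + t * d j))
      (∑ j, d j * (β * ((if j = i then smx β i (fun j => z j + t * d j) else 0)
        - smx β i (fun j => z j + t * d j) * smx β j (fun j => z j + t * d j)))) t := by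
  have h1 : ∀ j, HasDerivAt (fun t : ℝ => Real.exp (β * (z j + t * d j)))
      (Real.exp (β * (z j + t * d j)) * (β * d j)) t := fun j => by
    have := (((hasDerivAt_id t).mul_const (d j)).const_add (z j)).const_mul β
    simpa using this.exp
  have h2 := HasDerivAt.fun_sum (u := Finset.univ) fun j _ => h1 j
  have hpos := smx_den_pos β i (fun j => z j + t * d j)
  have h3 := (h1 i).fun_div h2 hpos.ne'
  refine h3.congr_deriv ?_
  simp only [mul_sub, Finset.sum_sub_distrib, mul_ite, mul_zero, Finset.sum_ite_eq',
    Finset.mem_univ, if_true]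
  have e : ∑ j, d j * (β * (smx β i (fun j => z j + t * d j) * smx β j (fun j => z j + t * d j)))
      = smx β i (fun j => z j + t * d j) *
        ((∑ j, Real.exp (β * (z j + t * d j)) * (β * d j)) /
          ∑ j, Real.exp (β * (z j + t * d j))) := by
    rw [Finset.sum_div, Finset.mul_sum]
    refine Finset.sum_congr rfl fun j _ => ?_
    simp only [smx]
    ring
  rw [e]
  simp only [smx]
  field_simp

lemma gibbs_ibp {Ω : Type} [MeasurableSpace Ω] (P : Measure Ω) [IsProbabilityMeasure P] {N : ℕ}
    (β : ℝ) (hβ : 0 < β) (i : Fin N)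
    (Y : Ω → ℝ) (X : Fin N → Ω → ℝ) (hY : Measurable Y) (hX : ∀ j, Measurable (X j))
    (hG : ∀ (b : ℝ) (a : Fin N → ℝ), ∃ v : NNReal,
      P.map (fun ω => b * Y ω + ∑ j, a j * X j ω) = gaussianReal 0 v)
    (s : ℝ) (hs : 0 < s) (hYs : ∫ ω, Y ω ^ 2 ∂P = s) :
    ∫ ω, Y ω * smx β i (fun j => X j ω) ∂P
      = β * ((∫ ω, Y ω * X i ω ∂P) * (∫ ω, smx β i (fun k => X k ω) ∂P)
        - ∑ j, (∫ ω, Y ω * X j ω ∂P) *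
          ∫ ω, smx β i (fun k => X k ω) * smx β j (fun k => X k ω) ∂P) := by
  have hint : ∀ j, Integrable (fun ω => smx β j (fun k => X k ω)) P := fun j =>
    Integrable.of_bound ((smx_cont β j).measurable.comp
      (measurable_pi_lambda _ hX)).aestronglyMeasurable 1
      (Filter.Eventually.of_forall fun ω => by
        rw [Real.norm_eq_abs, abs_of_nonneg (smx_nonneg _ _ _)]; exact smx_le_one _ _ _)
  have hint2 : ∀ j, Integrable (fun ω => smx β i (fun k => X k ω) * smx β j (fun k => X k ω)) P :=
    fun j => (hint j).bdd_mul (c := 1) (hint i).aestronglyMeasurable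
      (Filter.Eventually.of_forall fun ω => by
        rw [Real.norm_eq_abs, abs_of_nonneg (smx_nonneg _ _ _)]; exact smx_le_one _ _ _)
  have key := gibp P Y X hY hX hG s hs hYs (smx β i)
    (fun j x => β * ((if j = i then smx β i x else 0) - smx β i x * smx β j x))
    (fun z d t => smx_deriv β i z d t) (smx_cont β i) ?_ (max 1 β) ?_ ?_
  · rw [key]
    have : ∀ j, ∫ ω, β * ((if j = i then smx β i (fun k => X k ω) else 0)
        - smx β i (fun k => X k ω) * smx β j (fun k => X k ω)) ∂P
        = β * ((if j = i then ∫ ω, smx β i (fun k => X k ω) ∂P else 0)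
          - ∫ ω, smx β i (fun k => X k ω) * smx β j (fun k => X k ω) ∂P) := by
      intro j
      rw [integral_const_mul]
      congr 1
      split_ifs with h
      · exact integral_sub (hint i) (hint2 j)
      · simp [integral_neg]
    simp_rw [this]
    rw [mul_sub, Finset.mul_sum]
    simp only [mul_sub, Finset.sum_sub_distrib, mul_ite, mul_zero, Finset.sum_ite_eq',
      Finset.mem_univ, if_true]
    congr 1
    · ring
    · exact Finset.sum_congr rfl fun j _ => by ring
  · intro j
    have h1 := smx_cont β i
    have h2 := smx_cont β j
    split_ifs <;> fun_prop
  · intro x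
    rw [abs_of_nonneg (smx_nonneg _ _ _)]
    exact (smx_le_one _ _ _).trans (le_max_left _ _)
  · intro j x
    refine le_trans ?_ (le_max_right _ _)
    rw [abs_mul, abs_of_pos hβ]
    refine mul_le_of_le_one_right hβ.le ?_
    have h1 := smx_nonneg β i x
    have h2 := smx_nonneg β j x
    have h3 := smx_le_one β i x
    have h4 := smx_le_one β j x
    have h5 := mul_nonneg h1 h2
    have h6 := mul_le_mul h3 h4 h2 zero_le_one
    have h7 := mul_le_of_le_one_right h1 h4
    split_ifs <;> rw [abs_le] <;> constructor <;> linarith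

/-- Gaussian integration by parts for the Gibbs measure of the log-correlated field:
if `(X̃, X)` is jointly centered Gaussian with `E[X̃_x X_{x'}] = ((q(x,x')−α)⁺) log N + O(1)`,
then `(β log N)⁻¹ E[∑_x X̃_x G_{β,N}(x)] = ∫_α^1 E[G_{β,N}^{×2}{q₁₂ ≤ s}] ds + O(1/log N)`,
with a constant uniform in `N`. -/
theorem stmt18 (β α C : ℝ) (hβ : 0 < β) (hα : α ∈ Set.Ioo (0 : ℝ) 1) (hC : 0 ≤ C) :
    ∃ C' : ℝ, 0 < C' ∧ ∀ (N : ℕ), 2 ≤ N →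
    ∀ (Ω : Type) [MeasurableSpace Ω] (P : Measure Ω) [IsProbabilityMeasure P]
      (X Xt : Fin N → Ω → ℝ),
    (∀ i, Measurable (X i)) → (∀ i, Measurable (Xt i)) →
    (∀ a b : Fin N → ℝ, ∃ v : NNReal,
      P.map (fun ω => ∑ i, a i * X i ω + ∑ i, b i * Xt i ω) = gaussianReal 0 v) →
    (∀ i, ∫ ω, (Xt i ω) ^ 2 ∂P = (1 - α) * Real.log N) →
    (∀ i, ∫ ω, Xt i ω * X i ω ∂P = (1 - α) * Real.log N) →
    (∀ i j, i ≠ j → α < overlapQ N i j →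
      |(∫ ω, Xt i ω * X j ω ∂P) - (overlapQ N i j - α) * Real.log N| ≤ C) →
    (∀ i j, i ≠ j → overlapQ N i j ≤ α → ∫ ω, Xt i ω * X j ω ∂P = 0) →
    |(β * Real.log N)⁻¹ *
        ∫ ω, ∑ i, Xt i ω *
          (Real.exp (β * X i ω) / ∑ z, Real.exp (β * X z ω)) ∂P
      - ∫ s in α..(1 : ℝ), ∫ ω, ∑ i, ∑ j,
          (if overlapQ N i j ≤ s then
            (Real.exp (β * X i ω) / ∑ z, Real.exp (β * X z ω)) *
              (Real.exp (β * X j ω) / ∑ z, Real.exp (β * X z ω))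
          else 0) ∂P|
      ≤ C' / Real.log N := by
  refine ⟨C + 1, by linarith, ?_⟩
  intro N hN Ω _ P _ X Xt hX hXt hG hvar hdiag hoff hzero
  have hlog : 0 < Real.log N := Real.log_pos (by exact_mod_cast (by omega : 1 < N))
  have hs : 0 < (1 - α) * Real.log N := mul_pos (by linarith [hα.2]) hlog
  change |(β * Real.log N)⁻¹ * (∫ ω, ∑ i, Xt i ω * smx β i (fun k => X k ω) ∂P)
    - ∫ s in α..(1 : ℝ), ∫ ω, ∑ i, ∑ j, (if overlapQ N i j ≤ s then
        smx β i (fun k => X k ω) * smx β j (fun k => X k ω) else 0) ∂P| ≤ _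
  have hae : ∀ i, AEStronglyMeasurable (fun ω => smx β i (fun k => X k ω)) P := fun i =>
    ((smx_cont β i).measurable.comp (measurable_pi_lambda _ hX)).aestronglyMeasurable
  have hbd : ∀ i, ∀ᵐ ω ∂P, ‖smx β i (fun k => X k ω)‖ ≤ 1 := fun i =>
    Filter.Eventually.of_forall fun ω => by
      rw [Real.norm_eq_abs, abs_of_nonneg (smx_nonneg _ _ _)]; exact smx_le_one _ _ _
  have hint : ∀ i, Integrable (fun ω => smx β i (fun k => X k ω)) P := fun i =>
    Integrable.of_bound (hae i) 1 (hbd i)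
  have hint2 : ∀ i j,
      Integrable (fun ω => smx β i (fun k => X k ω) * smx β j (fun k => X k ω)) P :=
    fun i j => (hint j).bdd_mul (c := 1) (hae i) (hbd i)
  set e : Fin N → Fin N → ℝ := fun i j =>
    ∫ ω, smx β i (fun k => X k ω) * smx β j (fun k => X k ω) ∂P with he
  set c : Fin N → Fin N → ℝ := fun i j => ∫ ω, Xt i ω * X j ω ∂P with hc
  have he0 : ∀ i j, 0 ≤ e i j := fun i j =>
    integral_nonneg fun ω => mul_nonneg (smx_nonneg _ _ _) (smx_nonneg _ _ _)
  have he1 : ∀ i, ∑ j, e i j = ∫ ω, smx β i (fun k => X k ω) ∂P := by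
    intro i
    rw [he, ← integral_finsetSum _ fun j _ => hint2 i j]
    congr 1; ext ω
    rw [← Finset.mul_sum, smx_sum hN, mul_one]
  have he2 : ∑ i, ∑ j, e i j = 1 := by
    simp_rw [he1]
    rw [← integral_finsetSum _ fun j _ => hint j]
    simp_rw [smx_sum hN]
    simp
  have hA : (β * Real.log N)⁻¹ * (∫ ω, ∑ i, Xt i ω * smx β i (fun k => X k ω) ∂P)
      = ∑ i, ∑ j, e i j * ((1 - α) - c i j / Real.log N) := by
    have hXtint : ∀ i, Integrable (Xt i) P := by
      intro i
      have h2 : Integrable (fun ω => Xt i ω ^ 2) P := by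
        by_contra h
        have := hvar i
        rw [integral_undef h] at this
        linarith
      exact ((memLp_two_iff_integrable_sq (hXt i).aestronglyMeasurable).2 h2).integrable
        (by norm_num)
    have h1 : ∀ i, Integrable (fun ω => Xt i ω * smx β i (fun k => X k ω)) P := fun i =>
      ((hXtint i).bdd_mul (c := 1) (hae i) (hbd i)).congr
        (Filter.Eventually.of_forall fun ω => mul_comm _ _)
    rw [integral_finsetSum _ fun i _ => h1 i, Finset.mul_sum]
    refine Finset.sum_congr rfl fun i _ => ?_
    have hGi : ∀ (b : ℝ) (a : Fin N → ℝ), ∃ v : NNReal,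
        P.map (fun ω => b * Xt i ω + ∑ j, a j * X j ω) = gaussianReal 0 v := by
      intro b a
      obtain ⟨v, hv⟩ := hG a (Pi.single i b)
      refine ⟨v, ?_⟩
      rw [← hv]
      congr 1; ext ω
      simp [Pi.single_apply, add_comm]
    rw [gibbs_ibp P β hβ i (Xt i) X (hXt i) hX hGi _ hs (hvar i), ← he1 i, hdiag i]
    simp only [mul_sub, Finset.sum_sub_distrib]
    rw [← Finset.sum_mul]
    have : ∑ j, e i j * (c i j / Real.log N) = (∑ j, c i j * e i j) / Real.log N := by
      rw [Finset.sum_div]; exact Finset.sum_congr rfl fun j _ => by ring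
    rw [this]
    change _ - (β * Real.log N)⁻¹ * (β * ∑ j, c i j * e i j) = _
    field_simp
    rw [← Finset.mul_sum]
    ring
  have hB : (∫ s in α..(1 : ℝ), ∫ ω, ∑ i, ∑ j, (if overlapQ N i j ≤ s then
        smx β i (fun k => X k ω) * smx β j (fun k => X k ω) else 0) ∂P)
      = ∑ i, ∑ j, e i j * (1 - α - max (overlapQ N i j - α) 0) := by
    have h1 : ∀ s : ℝ, (∫ ω, ∑ i, ∑ j, (if overlapQ N i j ≤ s then
        smx β i (fun k => X k ω) * smx β j (fun k => X k ω) else 0) ∂P)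
        = ∑ i, ∑ j, (if overlapQ N i j ≤ s then e i j else 0) := by
      intro s
      have h2 : ∀ i j, Integrable (fun ω => if overlapQ N i j ≤ s then
          smx β i (fun k => X k ω) * smx β j (fun k => X k ω) else 0) P := by
        intro i j
        split_ifs
        · exact hint2 i j
        · exact integrable_zero _ _ _
      rw [integral_finsetSum _ fun i _ => integrable_finsetSum _ fun j _ => h2 i j]
      refine Finset.sum_congr rfl fun i _ => ?_
      rw [integral_finsetSum _ fun j _ => h2 i j]
      refine Finset.sum_congr rfl fun j _ => ?_
      split_ifs
      · rfl
      · simp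
    simp_rw [h1]
    have h3 := fun i j => integral_ind α (overlapQ N i j) (e i j) (he0 i j) hα.2.le
      (overlapQ_le_one N hN i j)
    rw [intervalIntegral.integral_finsetSum]
    · refine Finset.sum_congr rfl fun i _ => ?_
      rw [intervalIntegral.integral_finsetSum fun j _ => (h3 i j).1]
      exact Finset.sum_congr rfl fun j _ => (h3 i j).2
    · intro i _
      have h4 := IntervalIntegrable.sum Finset.univ fun j _ => (h3 i j).1
      have h5 : (fun s => ∑ j, (if overlapQ N i j ≤ s then e i j else 0))
          = ∑ j, fun s => (if overlapQ N i j ≤ s then e i j else 0) := by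
        ext s; simp
      rw [h5]
      exact h4
  rw [hA, hB, ← Finset.sum_sub_distrib]
  simp_rw [← Finset.sum_sub_distrib]
  have hterm : ∀ i j, |e i j * ((1 - α) - c i j / Real.log N)
      - e i j * (1 - α - max (overlapQ N i j - α) 0)| ≤ e i j * (C / Real.log N) := by
    intro i j
    have hre : e i j * ((1 - α) - c i j / Real.log N)
      - e i j * (1 - α - max (overlapQ N i j - α) 0)
      = e i j * (-(c i j - max (overlapQ N i j - α) 0 * Real.log N) / Real.log N) := by
      field_simp; ring
    rw [hre, abs_mul, abs_of_nonneg (he0 i j), abs_div, abs_neg, abs_of_pos hlog]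
    refine mul_le_mul_of_nonneg_left ?_ (he0 i j)
    refine div_le_div_of_nonneg_right ?_ hlog.le
    by_cases hij : i = j
    · subst hij
      have hq : overlapQ N i i = 1 := by simp [overlapQ]
      rw [hq, max_eq_left (by linarith [hα.2])]
      have : c i i = (1 - α) * Real.log N := hdiag i
      rw [this]
      simpa using hC
    · rcases lt_or_ge α (overlapQ N i j) with h | h
      · rw [max_eq_left (by linarith)]
        exact hoff i j hij h
      · rw [max_eq_right (by linarith)]
        have : c i j = 0 := hzero i j hij h
        rw [this]
        simpa using hC
  calc _ ≤ ∑ i, ∑ j, e i j * (C / Real.log N) :=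
        (Finset.abs_sum_le_sum_abs _ _).trans (Finset.sum_le_sum fun i _ =>
          (Finset.abs_sum_le_sum_abs _ _).trans (Finset.sum_le_sum fun j _ => hterm i j))
    _ = C / Real.log N := by
        simp_rw [← Finset.sum_mul]
        rw [he2, one_mul]
    _ ≤ (C + 1) / Real.log N := by
        gcongr; linarith
end
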